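/- For every C*-algebra A, every element F of M_n(ℂ^m ⊗ A) ≅ M_n(A)^m with ‖F‖ ≤ 1 (maximum of the norms of the m components F_1,…,F_m ∈ M_n(A)) admits a factorization F = D ⊙ E with D ∈ M_{n,nm}(ℂ^m), E ∈ M_{nm,n}(A) and ‖D‖·‖E‖ ≤ √m. -/

import Mathlib

open scoped Matrix

/-- The norm of a column vector over a C*-algebra, `‖v‖ = ‖∑ vᵢ* vᵢ‖^{1/2}`. -/
noncomputable def colNorm {A ι : Type*} [Fintype ι] [NonUnitalNormedRing A] [StarRing A]
    (v : ι → A) : ℝ :=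
  Real.sqrt ‖∑ i, star (v i) * v i‖

/-- The canonical C*-norm of a rectangular matrix over a C*-algebra `A`, i.e. its norm
as an operator between the standard Hilbert C*-modules `A^κ → A^ι`. -/
noncomputable def matNorm {A ι κ : Type*} [Fintype ι] [Fintype κ]
    [NonUnitalNormedRing A] [StarRing A] (M : Matrix ι κ A) : ℝ :=
  sSup ((fun v => colNorm (M.mulVec v)) '' {v : κ → A | colNorm v ≤ 1})

namespace UniformSpace.Completion

variable {B : Type*} [NormedRing B] [StarRing B] [CStarRing B]

theorem uniformContinuous_star : UniformContinuous (star : B → B) :=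
  star_isometry.uniformContinuous

/-- The involution of a unital pre-C*-algebra, extended to its completion. -/
noncomputable abbrev starRing : StarRing (Completion B) :=
  have hu := uniformContinuous_star (B := B)
  have hc : Continuous (Completion.map (star : B → B)) := continuous_map
  { star := Completion.map star
    star_involutive := fun x => by
      induction x using Completion.induction_on with
      | hp => exact isClosed_eq (hc.comp hc) continuous_id
      | ih a => simp [Completion.map_coe hu]
    star_mul := fun x y => by
      induction x, y using Completion.induction_on₂ with
      | hp =>
        exact isClosed_eq (hc.comp continuous_mul)
          ((hc.comp continuous_snd).mul (hc.comp continuous_fst))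
      | ih a b =>
        rw [← coe_mul, Completion.map_coe hu, Completion.map_coe hu, Completion.map_coe hu,
          star_mul, coe_mul]
    star_add := fun x y => by
      induction x, y using Completion.induction_on₂ with
      | hp =>
        exact isClosed_eq (hc.comp continuous_add)
          ((hc.comp continuous_fst).add (hc.comp continuous_snd))
      | ih a b =>
        rw [← coe_add, Completion.map_coe hu, Completion.map_coe hu, Completion.map_coe hu,
          star_add, coe_add] }

attribute [local instance] starRing

theorem coe_star (a : B) : ((star a : B) : Completion B) = star (a : Completion B) :=
  (Completion.map_coe uniformContinuous_star a).symm

theorem continuous_star_completion : Continuous (star : Completion B → Completion B) :=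
  continuous_map

/-- The completion of a unital pre-C*-algebra is a C*-algebra. -/
noncomputable abbrev cstarAlgebra [NormedAlgebra ℂ B] [StarModule ℂ B] :
    CStarAlgebra (Completion B) where
  norm_mul_self_le x := by
    induction x using Completion.induction_on with
    | hp =>
      exact isClosed_le (by fun_prop)
        (continuous_norm.comp (continuous_star_completion.mul continuous_id))
    | ih a =>
      rw [← coe_star, ← coe_mul, norm_coe, norm_coe]
      exact CStarRing.norm_mul_self_le a
  norm_smul_le := norm_smul_le
  star_smul c x := by
    induction x using Completion.induction_on with
    | hp =>
      exact isClosed_eq (continuous_star_completion.comp (continuous_const_smul c))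
        (continuous_star_completion.const_smul (star c))
    | ih a => rw [← coe_smul, ← coe_star, ← coe_star, star_smul, coe_smul]

end UniformSpace.Completion

theorem CStarAlgebra.norm_sq_le_norm_sum_star_mul_self {B ι : Type*} [CStarAlgebra B] [Fintype ι]
    (v : ι → B) (i : ι) : ‖v i‖ ^ 2 ≤ ‖∑ j, star (v j) * v j‖ := by
  let _ : PartialOrder B := CStarAlgebra.spectralOrder B
  have _ : StarOrderedRing B := CStarAlgebra.spectralOrderedRing B
  rw [sq, ← CStarRing.norm_star_mul_self]
  exact CStarAlgebra.norm_le_norm_of_nonneg_of_le (star_mul_self_nonneg _)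
    (Finset.single_le_sum (f := fun j => star (v j) * v j)
      (fun j _ => star_mul_self_nonneg _) (Finset.mem_univ i))

section PreCStar

variable {A : Type*} [NonUnitalNormedRing A] [StarRing A] [CStarRing A]
    [NormedSpace ℂ A] [IsScalarTower ℂ A A] [SMulCommClass ℂ A A] [StarModule ℂ A]

open DoubleCentralizer in
theorem DoubleCentralizer.norm_coeHom (a : A) : ‖coeHom (𝕜 := ℂ) a‖ = ‖a‖ := by
  rw [← norm_fst]
  exact ContinuousLinearMap.opNorm_mul_apply ℂ A a

theorem norm_le_colNorm {ι : Type*} [Fintype ι] (v : ι → A) (i : ι) : ‖v i‖ ≤ colNorm v := by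
  let _ := UniformSpace.Completion.cstarAlgebra (B := DoubleCentralizer ℂ A)
  have h := CStarAlgebra.norm_sq_le_norm_sum_star_mul_self
    (fun j => ((DoubleCentralizer.coeHom (𝕜 := ℂ) (v j) : DoubleCentralizer ℂ A) :
      UniformSpace.Completion (DoubleCentralizer ℂ A))) i
  apply Real.le_sqrt_of_sq_le
  convert h using 1
  · rw [UniformSpace.Completion.norm_coe, DoubleCentralizer.norm_coeHom]
  · rw [← DoubleCentralizer.norm_coeHom, ← UniformSpace.Completion.norm_coe, map_sum]
    refine congrArg norm (.trans (map_sum UniformSpace.Completion.coeRingHom _ _) ?_)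
    refine Finset.sum_congr rfl fun j _ => ?_
    rw [map_mul, map_star, map_mul, ← UniformSpace.Completion.coe_star]
    rfl

theorem bddAbove_colNorm_mulVec {ι κ : Type*} [Fintype ι] [Fintype κ] (M : Matrix ι κ A) :
    BddAbove ((fun v => colNorm (M.mulVec v)) '' {v : κ → A | colNorm v ≤ 1}) := by
  refine ⟨Real.sqrt (∑ i, (∑ j, ‖M i j‖) ^ 2), ?_⟩
  rintro _ ⟨v, hv, rfl⟩
  refine Real.sqrt_le_sqrt ((norm_sum_le _ _).trans (Finset.sum_le_sum fun i _ => ?_))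
  rw [CStarRing.norm_star_mul_self, ← sq]
  gcongr
  refine (norm_sum_le _ _).trans (Finset.sum_le_sum fun j _ => (norm_mul_le _ _).trans ?_)
  exact mul_le_of_le_one_right (norm_nonneg _) ((norm_le_colNorm v j).trans hv)

theorem colNorm_mulVec_le_matNorm {ι κ : Type*} [Fintype ι] [Fintype κ] (M : Matrix ι κ A)
    {v : κ → A} (hv : colNorm v ≤ 1) : colNorm (M.mulVec v) ≤ matNorm M :=
  le_csSup (bddAbove_colNorm_mulVec M) ⟨v, hv, rfl⟩

/-- Stacking `m` matrices of norm at most one gives a matrix of norm at most `√m`. -/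
theorem matNorm_stack_le {ι κ μ : Type*} [Fintype ι] [Fintype κ] [Fintype μ]
    (F : μ → Matrix ι κ A) (hF : ∀ k, matNorm (F k) ≤ 1) :
    matNorm (Matrix.of fun (s : ι × μ) j => F s.2 s.1 j) ≤ Real.sqrt (Fintype.card μ) := by
  refine Real.sSup_le ?_ (Real.sqrt_nonneg _)
  rintro _ ⟨v, hv, rfl⟩
  refine Real.sqrt_le_sqrt ?_
  rw [Fintype.sum_prod_type_right]
  refine (norm_sum_le _ _).trans ?_
  refine (Finset.sum_le_card_nsmul _ _ 1 fun k _ => ?_).trans (by simp)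
  exact Real.sqrt_le_one.mp ((colNorm_mulVec_le_matNorm (F k) hv).trans (hF k))

end PreCStar

/-- The matrix over `ℂ^μ` whose `(i, (i', k))` entry is `δ i i'` times the `k`-th unit vector. -/
def unstack (ι μ : Type*) [DecidableEq ι] [DecidableEq μ] : Matrix ι (ι × μ) (μ → ℂ) :=
  Matrix.of fun i s => if i = s.1 then Pi.single s.2 1 else 0

theorem unstack_mulVec_apply {ι μ : Type*} [Fintype ι] [Fintype μ] [DecidableEq ι] [DecidableEq μ]
    (v : ι × μ → μ → ℂ) (i : ι) (k : μ) : (unstack ι μ).mulVec v i k = v (i, k) k := by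
  simp [unstack, Matrix.mulVec, dotProduct, Fintype.sum_prod_type, Finset.sum_apply,
    Pi.single_apply, ite_mul]

theorem Complex.norm_sum_star_mul_self {ι : Type*} (s : Finset ι) (f : ι → ℂ) :
    ‖∑ i ∈ s, star (f i) * f i‖ = ∑ i ∈ s, ‖f i‖ ^ 2 := by
  have h : ∑ i ∈ s, star (f i) * f i = ((∑ i ∈ s, ‖f i‖ ^ 2 : ℝ) : ℂ) := by
    simp [Complex.conj_mul']
  rw [h, Complex.norm_of_nonneg (by positivity)]

theorem matNorm_unstack_le {ι μ : Type*} [Fintype ι] [Fintype μ] [DecidableEq ι] [DecidableEq μ] :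
    matNorm (unstack ι μ) ≤ 1 := by
  refine Real.sSup_le ?_ zero_le_one
  rintro _ ⟨v, hv, rfl⟩
  refine le_trans (Real.sqrt_le_sqrt ?_) hv
  refine (pi_norm_le_iff_of_nonneg (norm_nonneg _)).2 fun k => ?_
  refine le_trans ?_ (norm_le_pi_norm _ k)
  simp only [Finset.sum_apply, Pi.mul_apply, Pi.star_apply, unstack_mulVec_apply,
    Complex.norm_sum_star_mul_self]
  rw [Fintype.sum_prod_type]
  exact Finset.sum_le_sum fun i _ =>
    Finset.single_le_sum (f := fun l => ‖v (i, l) k‖ ^ 2) (fun _ _ => by positivity)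
      (Finset.mem_univ k)

/-- Every `F ∈ M_n(ℂ^m ⊗ A) ≅ M_n(A)^m` of norm at most one (i.e. each component
`F_k ∈ M_n(A)` has norm at most one) factors as `F = D ⊙ E` with
`D ∈ M_{n,nm}(ℂ^m)`, `E ∈ M_{nm,n}(A)` and `‖D‖ ‖E‖ ≤ √m`. -/
theorem stmt_14 {A : Type*} [NonUnitalNormedRing A] [StarRing A] [CStarRing A]
    [NormedSpace ℂ A] [IsScalarTower ℂ A A] [SMulCommClass ℂ A A] [StarModule ℂ A]
    {n m : ℕ} (hn : 0 < n) (hm : 0 < m)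
    (F : Fin m → Matrix (Fin n) (Fin n) A) (hF : ∀ k, matNorm (F k) ≤ 1) :
    ∃ (D : Matrix (Fin n) (Fin n × Fin m) (Fin m → ℂ))
      (E : Matrix (Fin n × Fin m) (Fin n) A),
      (∀ (i j : Fin n) (k : Fin m), (∑ s : Fin n × Fin m, D i s k • E s j) = F k i j) ∧
        matNorm D * matNorm E ≤ Real.sqrt m := by
  refine ⟨unstack (Fin n) (Fin m), Matrix.of fun s j => F s.2 s.1 j, fun i j k => ?_, ?_⟩
  · simp [unstack, Fintype.sum_prod_type, ite_apply, Pi.single_apply, ite_smul]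
  · refine (mul_le_mul matNorm_unstack_le (matNorm_stack_le F hF) ?_ zero_le_one).trans (by simp)
    exact Real.sSup_nonneg (by rintro _ ⟨v, _, rfl⟩; exact Real.sqrt_nonneg _)
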